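/- arXiv:math/0302131 — 5 statements merged into one kernel-verified Lean document; each statement's English description precedes it below -/
import Mathlib

section
/- Let G be a group and ρ : G → Sp(1) an irreducible projective representation, i.e. the centralizer of the image of ρ in Sp(1) equals {±1}. Let α : G → {±1} be a nontrivial group homomorphism and suppose u ∈ Sp(1) satisfies α(x)·ρ(x) = u·ρ(x)·u⁻¹ for all x ∈ G. Then u² = −1. -/
open Quaternion

/-- If `ρ : G → Sp(1)` is an irreducible projective representation (the centralizer of its
image in the unit quaternions is `{±1}`), `α : G → {±1}` is a nontrivial homomorphism, and
`u` is a unit quaternion with `α(x)·ρ(x) = u·ρ(x)·u⁻¹` for all `x`, then `u² = -1`. -/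
theorem sq_eq_neg_one_of_twist_conj {G : Type*} [Group G]
    (ρ : G → ℍ[ℝ]) (hρ : ∀ g, ‖ρ g‖ = 1)
    (hpr : ∀ g h : G, ρ (g * h) * (ρ h)⁻¹ * (ρ g)⁻¹ = 1 ∨
      ρ (g * h) * (ρ h)⁻¹ * (ρ g)⁻¹ = -1)
    (hirr : ∀ z : ℍ[ℝ], ‖z‖ = 1 → (∀ x : G, z * ρ x = ρ x * z) → z = 1 ∨ z = -1)
    (α : G → ℍ[ℝ]) (hα : ∀ x, α x = 1 ∨ α x = -1)
    (hαhom : ∀ x y : G, α (x * y) = α x * α y)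
    (hαnt : ∃ x : G, α x ≠ 1)
    (u : ℍ[ℝ]) (hu : ‖u‖ = 1)
    (hconj : ∀ x : G, α x * ρ x = u * ρ x * u⁻¹) :
    u ^ 2 = -1 := by
  have hu0 : u ≠ 0 := by
    intro h
    simp [h] at hu
  have hr0 : ∀ x, ρ x ≠ 0 := by
    intro x h
    have h1 := hρ x
    simp [h] at h1
  have h1 : ∀ x, α x * ρ x * u = u * ρ x := by
    intro x
    rw [hconj x, mul_assoc, inv_mul_cancel₀ hu0, mul_one]
  have hc : ∀ x, u ^ 2 * ρ x = ρ x * u ^ 2 := by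
    intro x
    have h2 := h1 x
    rcases hα x with h | h
    · rw [h, one_mul] at h2
      rw [pow_two, mul_assoc, ← h2, ← mul_assoc, ← h2, mul_assoc]
    · rw [h, neg_one_mul, neg_mul] at h2
      rw [pow_two, mul_assoc, ← h2, mul_neg, ← mul_assoc, ← h2, neg_mul, neg_neg, mul_assoc]
  rcases hirr (u ^ 2) (by rw [norm_pow, hu, one_pow]) hc with h | h
  · exfalso
    obtain ⟨x, hx⟩ := hαnt
    apply hx
    have h3 : α x * ρ x = 1 * ρ x := by
      rcases (mul_self_eq_one_iff.mp ((pow_two u).symm.trans h)) with h | h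
      · rw [hconj x, h]; simp
      · rw [hconj x, h, inv_neg]; simp
    exact mul_right_cancel₀ (hr0 x) h3
  · exact h
end

section
/- Let G be a group and ρ : G → Sp(1) an irreducible projective representation. Let α, β : G → {±1} be group homomorphisms such that α, β and α·β are all nontrivial (i.e. α and β are linearly independent in Hom(G, ℤ/2)). Suppose there exist u, v ∈ Sp(1) with α(x)·ρ(x) = u·ρ(x)·u⁻¹ and β(x)·ρ(x) = v·ρ(x)·v⁻¹ for all x ∈ G. Then there exists σ ∈ Sp(1) such that σ·ρ(x)·σ⁻¹ ∈ {±1, ±i, ±j, ±k} for all x ∈ G, i.e. after conjugation the image of ρ is contained in the quaternion group Q. -/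
open Quaternion

/-- The quaternion `i`. -/
noncomputable def qi : ℍ[ℝ] := ⟨0, 1, 0, 0⟩

/-- The quaternion `j`. -/
noncomputable def qj : ℍ[ℝ] := ⟨0, 0, 1, 0⟩

/-- The quaternion `k`. -/
noncomputable def qk : ℍ[ℝ] := ⟨0, 0, 0, 1⟩

/-- The quaternion group `Q = {±1, ±i, ±j, ±k}`. -/
noncomputable def Qset : Set ℍ[ℝ] := {1, -1, qi, -qi, qj, -qj, qk, -qk}

@[simp] lemma qi_re : qi.re = 0 := rfl

@[simp] lemma qi_imI : qi.imI = 1 := rfl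

@[simp] lemma qi_imJ : qi.imJ = 0 := rfl

@[simp] lemma qi_imK : qi.imK = 0 := rfl

@[simp] lemma qj_re : qj.re = 0 := rfl

@[simp] lemma qj_imI : qj.imI = 0 := rfl

@[simp] lemma qj_imJ : qj.imJ = 1 := rfl

@[simp] lemma qj_imK : qj.imK = 0 := rfl

@[simp] lemma qk_re : qk.re = 0 := rfl

@[simp] lemma qk_imI : qk.imI = 0 := rfl

@[simp] lemma qk_imJ : qk.imJ = 0 := rfl

@[simp] lemma qk_imK : qk.imK = 1 := rfl

lemma qi_sq : qi * qi = -1 := by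
  ext <;> simp

lemma qj_sq : qj * qj = -1 := by
  ext <;> simp

lemma qi_qj : qi * qj = qk := by
  ext <;> simp

lemma qj_qi : qj * qi = -qk := by
  ext <;> simp

lemma qi_ne : qi ≠ 0 := by
  intro h
  have := qi_sq
  rw [h] at this
  simp at this

lemma qj_ne : qj ≠ 0 := by
  intro h
  have := qj_sq
  rw [h] at this
  simp at this

/-- Anticommuting square roots of `-1` are simultaneously conjugate to `i, j`. -/
lemma exists_frame (u v : ℍ[ℝ]) (hu : u * u = -1) (hv : v * v = -1) (huv : v * u = -(u * v)) :
    ∃ s : ℍ[ℝ], s ≠ 0 ∧ s * u = qi * s ∧ s * v = qj * s := by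
  obtain ⟨s, hs, hsu⟩ : ∃ s : ℍ[ℝ], s ≠ 0 ∧ s * u = qi * s := by
    by_cases h : 1 - qi * u = 0
    · refine ⟨qj, qj_ne, ?_⟩
      have h2 : u = -qi := by
        have : qi * (1 - qi * u) = qi + u := by
          rw [mul_sub, ← mul_assoc, qi_sq]; simp
        rw [h, mul_zero] at this
        exact (neg_eq_of_add_eq_zero_right this.symm).symm
      rw [h2, qi_qj, mul_neg, qj_qi, neg_neg]
    · refine ⟨_, h, ?_⟩
      rw [mul_sub, sub_mul, mul_assoc, hu, ← mul_assoc qi qi, qi_sq]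
      simp [add_comm]
  set w := s * v * s⁻¹ with hw
  have hsv : s * v = w * s := by rw [hw, mul_assoc, inv_mul_cancel₀ hs, mul_one]
  have hww : w * w = -1 := by
    apply mul_right_cancel₀ hs
    rw [mul_assoc, ← hsv, ← mul_assoc, ← hsv, mul_assoc, hv]; simp
  have hwi : w * qi = -(qi * w) := by
    apply mul_right_cancel₀ hs
    rw [mul_assoc, ← hsu, ← mul_assoc, ← hsv, mul_assoc, huv, neg_mul, mul_assoc qi, ← hsv,
      ← mul_assoc qi, ← hsu]
    simp [mul_assoc]
  obtain ⟨t, ht, hti, htw⟩ : ∃ t : ℍ[ℝ], t ≠ 0 ∧ t * qi = qi * t ∧ t * w = qj * t := by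
    by_cases h : 1 - qj * w = 0
    · refine ⟨qi, qi_ne, rfl, ?_⟩
      have h2 : w = -qj := by
        have : qj * (1 - qj * w) = qj + w := by
          rw [mul_sub, ← mul_assoc, qj_sq]; simp
        rw [h, mul_zero] at this
        exact (neg_eq_of_add_eq_zero_right this.symm).symm
      rw [h2, qj_qi, mul_neg, qi_qj]
    · refine ⟨_, h, ?_, ?_⟩
      · rw [mul_sub, sub_mul, mul_assoc, hwi, ← mul_assoc qi qj, qi_qj, mul_neg, ← mul_assoc,
          qj_qi]
        simp
      · rw [mul_sub, sub_mul, mul_assoc, hww, ← mul_assoc qj qj, qj_sq]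
        simp [add_comm]
  refine ⟨t * s, mul_ne_zero ht hs, ?_, ?_⟩
  · rw [mul_assoc, hsu, ← mul_assoc, hti, mul_assoc]
  · rw [mul_assoc, hsv, ← mul_assoc, htw, mul_assoc]

/-- A unit quaternion commuting up to sign with `i` and `j` lies in `Q`. -/
lemma mem_Qset (q : ℍ[ℝ]) (hq : ‖q‖ = 1) (hi : qi * q = q * qi ∨ qi * q = -(q * qi))
    (hj : qj * q = q * qj ∨ qj * q = -(q * qj)) : q ∈ Qset := by
  have hn : q.re * q.re + q.imI * q.imI + q.imJ * q.imJ + q.imK * q.imK = 1 := by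
    have := Quaternion.normSq_eq_norm_mul_self q
    rw [hq, Quaternion.normSq_def'] at this
    linarith
  have ext4 : ∀ p : ℍ[ℝ], p = q ↔ p.re = q.re ∧ p.imI = q.imI ∧ p.imJ = q.imJ ∧ p.imK = q.imK :=
    fun p => Quaternion.ext_iff
  simp only [Quaternion.ext_iff, Quaternion.re_mul, Quaternion.imI_mul,
    Quaternion.imJ_mul, Quaternion.imK_mul, Quaternion.re_neg, Quaternion.imI_neg,
    Quaternion.imJ_neg, Quaternion.imK_neg, qi_re, qi_imI, qi_imJ, qi_imK,
    qj_re, qj_imI, qj_imJ, qj_imK] at hi hj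
  simp only [Qset, Set.mem_insert_iff, Set.mem_singleton_iff, eq_comm (a := q), ext4,
    Quaternion.re_neg, Quaternion.imI_neg, Quaternion.imJ_neg, Quaternion.imK_neg,
    Quaternion.re_one, Quaternion.imI_one, Quaternion.imJ_one, Quaternion.imK_one,
    qi_re, qi_imI, qi_imJ, qi_imK, qj_re, qj_imI, qj_imJ, qj_imK, qk_re, qk_imI, qk_imJ, qk_imK]
  generalize q.re = a at *
  generalize q.imI = b at *
  generalize q.imJ = c at *
  generalize q.imK = d at *
  have hlin : (b = 0 ∧ c = 0 ∧ d = 0) ∨ (a = 0 ∧ c = 0 ∧ d = 0) ∨ (a = 0 ∧ b = 0 ∧ d = 0) ∨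
      (a = 0 ∧ b = 0 ∧ c = 0) := by
    rcases hi with ⟨h1, h2, h3, h4⟩ | ⟨h1, h2, h3, h4⟩ <;>
    rcases hj with ⟨k1, k2, k3, k4⟩ | ⟨k1, k2, k3, k4⟩
    · left; refine ⟨?_, ?_, ?_⟩ <;> linarith
    · right; left; refine ⟨?_, ?_, ?_⟩ <;> linarith
    · right; right; left; refine ⟨?_, ?_, ?_⟩ <;> linarith
    · right; right; right; refine ⟨?_, ?_, ?_⟩ <;> linarith
  clear hi hj ext4
  rcases hlin with ⟨rfl, rfl, rfl⟩ | ⟨rfl, rfl, rfl⟩ | ⟨rfl, rfl, rfl⟩ | ⟨rfl, rfl, rfl⟩ <;>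
    simp only [mul_zero, add_zero, zero_add] at hn <;>
    rcases mul_self_eq_one_iff.mp hn with rfl | rfl <;> simp

/-- Let `ρ : G → Sp(1)` be an irreducible projective representation and `α, β : G → {±1}`
homomorphisms with `α`, `β`, `α·β` all nontrivial.  If there are unit quaternions `u, v`
with `α(x)·ρ(x) = u·ρ(x)·u⁻¹` and `β(x)·ρ(x) = v·ρ(x)·v⁻¹` for all `x`, then after
conjugation by some `σ ∈ Sp(1)` the image of `ρ` is contained in `Q = {±1, ±i, ±j, ±k}`. -/
theorem image_in_quaternion_group {G : Type*} [Group G]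
    (ρ : G → ℍ[ℝ]) (hρ : ∀ g, ‖ρ g‖ = 1)
    (hpr : ∀ g h : G, ρ (g * h) * (ρ h)⁻¹ * (ρ g)⁻¹ = 1 ∨
      ρ (g * h) * (ρ h)⁻¹ * (ρ g)⁻¹ = -1)
    (hirr : ∀ z : ℍ[ℝ], ‖z‖ = 1 → (∀ x : G, z * ρ x = ρ x * z) → z = 1 ∨ z = -1)
    (α β : G → ℍ[ℝ])
    (hα : ∀ x, α x = 1 ∨ α x = -1) (hβ : ∀ x, β x = 1 ∨ β x = -1)
    (hαhom : ∀ x y : G, α (x * y) = α x * α y)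
    (hβhom : ∀ x y : G, β (x * y) = β x * β y)
    (hαnt : ∃ x : G, α x ≠ 1) (hβnt : ∃ x : G, β x ≠ 1)
    (hαβnt : ∃ x : G, α x * β x ≠ 1)
    (u v : ℍ[ℝ]) (hu : ‖u‖ = 1) (hv : ‖v‖ = 1)
    (hcu : ∀ x : G, α x * ρ x = u * ρ x * u⁻¹)
    (hcv : ∀ x : G, β x * ρ x = v * ρ x * v⁻¹) :
    ∃ σ : ℍ[ℝ], ‖σ‖ = 1 ∧ ∀ x : G, σ * ρ x * σ⁻¹ ∈ Qset := by
  have hρ0 : ∀ x, ρ x ≠ 0 := fun x h => by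
    have := hρ x
    rw [h] at this
    simp at this
  -- a unit quaternion twisting `ρ` by a nontrivial sign squares to `-1`
  have key : ∀ (γ : G → ℍ[ℝ]) (w : ℍ[ℝ]), ‖w‖ = 1 → (∀ x, γ x = 1 ∨ γ x = -1) →
      (∃ x, γ x ≠ 1) → (∀ x, w * ρ x = γ x * ρ x * w) → w * w = -1 := by
    intro γ w hw hγ hnt hc
    have h1 : w * w = 1 ∨ w * w = -1 := by
      apply hirr _ (by rw [norm_mul, hw, mul_one])
      intro x
      have := hc x
      rcases hγ x with h | h <;> rw [h] at this
      · rw [one_mul] at this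
        rw [mul_assoc, this, ← mul_assoc, this, mul_assoc]
      · rw [neg_mul, one_mul, neg_mul] at this
        rw [mul_assoc, this, mul_neg, ← mul_assoc, this, neg_mul, neg_neg, mul_assoc]
    refine h1.resolve_left fun h => ?_
    obtain ⟨x, hx⟩ := hnt
    apply hx
    have h2 := hc x
    apply mul_right_cancel₀ (hρ0 x)
    rcases mul_self_eq_one_iff.mp h with h | h <;> rw [h] at h2 <;> simpa using h2.symm
  have hu0 : u ≠ 0 := fun h => by rw [h] at hu; simp at hu
  have hv0 : v ≠ 0 := fun h => by rw [h] at hv; simp at hv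
  have hcu' : ∀ x, u * ρ x = α x * ρ x * u := fun x => by
    rw [hcu x, mul_assoc (u * ρ x), inv_mul_cancel₀ hu0, mul_one]
  have hcv' : ∀ x, v * ρ x = β x * ρ x * v := fun x => by
    rw [hcv x, mul_assoc (v * ρ x), inv_mul_cancel₀ hv0, mul_one]
  have huu := key α u hu hα hαnt hcu'
  have hvv := key β v hv hβ hβnt hcv'
  have huv2 : (u * v) * (u * v) = -1 := by
    refine key (fun x => α x * β x) (u * v) (by rw [norm_mul, hu, hv, mul_one]) ?_ hαβnt ?_
    · intro x
      rcases hα x with h | h <;> rcases hβ x with h' | h' <;> simp [h, h']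
    · intro x
      have h1 := hcu' x
      have h2 := hcv' x
      rw [mul_assoc, h2]
      rcases hα x with h | h <;> rcases hβ x with h' | h' <;> rw [h] at h1 ⊢ <;> rw [h'] <;>
        simp only [one_mul, neg_mul, mul_neg, neg_neg] at h1 ⊢ <;>
        simp only [← mul_assoc, h1, neg_mul, neg_neg]
  have huv : v * u = -(u * v) := by
    have : u * ((u * v) * (u * v)) * v = (u * u) * (v * u) * (v * v) := by
      simp only [mul_assoc]
    rw [huv2, huu, hvv] at this
    simpa using this.symm
  obtain ⟨s, hs, hsu, hsv⟩ := exists_frame u v huu hvv huv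
  have hn : ‖s‖ ≠ 0 := norm_ne_zero_iff.mpr hs
  refine ⟨(‖s‖⁻¹ : ℝ) • s, by rw [norm_smul]; simp [hn], fun x => ?_⟩
  have hconj : ((‖s‖⁻¹ : ℝ) • s) * ρ x * ((‖s‖⁻¹ : ℝ) • s)⁻¹ = s * ρ x * s⁻¹ := by
    rw [smul_inv₀, smul_mul_assoc, smul_mul_smul_comm]
    simp [hn]
  rw [hconj]
  have hsρ : s * ρ x = s * ρ x * s⁻¹ * s := by rw [mul_assoc, inv_mul_cancel₀ hs, mul_one]
  have tr : ∀ w p γ : ℍ[ℝ], (γ = 1 ∨ γ = -1) → w * ρ x = γ * ρ x * w → s * w = p * s →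
      p * (s * ρ x * s⁻¹) = s * ρ x * s⁻¹ * p ∨ p * (s * ρ x * s⁻¹) = -(s * ρ x * s⁻¹ * p) := by
    intro w p γ hγ hw hp
    have e1 : p * (s * ρ x * s⁻¹) * s = s * (w * ρ x) := by
      rw [mul_assoc p, ← hsρ, ← mul_assoc, ← hp, mul_assoc]
    have e2 : s * ρ x * s⁻¹ * p * s = s * (ρ x * w) := by
      rw [mul_assoc _ p, ← hp, ← mul_assoc, ← hsρ, mul_assoc]
    rcases hγ with h | h <;> rw [h] at hw
    · left
      apply mul_right_cancel₀ hs
      rw [e1, e2, hw, one_mul]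
    · right
      apply mul_right_cancel₀ hs
      rw [e1, neg_mul, e2, hw]
      simp
  apply mem_Qset
  · rw [norm_mul, norm_mul, norm_inv, hρ x, mul_one, mul_inv_cancel₀ hn]
  · exact tr u qi (α x) (hα x) (hcu' x) hsu
  · exact tr v qj (β x) (hβ x) (hcv' x) hsv
end

section
/- Let G be a group and let α, β, γ : G → {±1} be group homomorphisms that are linearly independent in Hom(G, ℤ/2) (equivalently, every product of a nonempty subset of {α, β, γ} is a nontrivial homomorphism). Then there is no irreducible projective representation ρ : G → Sp(1) such that each of ρ^α, ρ^β, ρ^γ is conjugate to ρ in Sp(1), where ρ^χ(x) = χ(x)·ρ(x). -/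
open Quaternion

theorem sq_eq_neg_one_of_twist {G : Type*} (ρ χ : G → ℍ[ℝ])
    (hχ : ∀ x, χ x = 1 ∨ χ x = -1) (hnt : ∃ x, χ x ≠ 1)
    (hρ : ∀ g, ‖ρ g‖ = 1)
    (hirr : ∀ z : ℍ[ℝ], ‖z‖ = 1 → (∀ x : G, z * ρ x = ρ x * z) → z = 1 ∨ z = -1)
    (p : ℍ[ℝ]) (hp : ‖p‖ = 1) (h : ∀ x, p * ρ x = χ x * (ρ x * p)) : p * p = -1 := by
  have h2 : ∀ x, p * p * ρ x = ρ x * (p * p) := by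
    intro x
    rcases hχ x with hx | hx
    · have := h x
      rw [hx, one_mul] at this
      rw [mul_assoc, this, ← mul_assoc, this, mul_assoc]
    · have := h x
      rw [hx, neg_one_mul] at this
      rw [mul_assoc, this, mul_neg, ← mul_assoc, this, neg_mul, neg_neg, mul_assoc]
  rcases hirr (p * p) (by rw [norm_mul, hp, one_mul]) h2 with h3 | h3
  · exfalso
    obtain ⟨x, hx⟩ := hnt
    have hx' := (hχ x).resolve_left hx
    have hr : ρ x ≠ 0 := by
      intro h0
      have := hρ x
      simp [h0] at this
    have key := h x
    rw [hx', neg_one_mul] at key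
    have h1 : ρ x = -ρ x := by
      rcases mul_self_eq_one_iff.mp h3 with h4 | h4
      · simpa [h4] using key
      · have := key
        rw [h4] at this
        simp only [neg_mul, one_mul, mul_neg, mul_one, neg_neg] at this
        exact this.symm
    apply hr
    have h5 : (2 : ℝ) • ρ x = 0 := by
      rw [two_smul]
      exact add_eq_zero_iff_eq_neg.mpr h1
    exact (smul_eq_zero.mp h5).resolve_left two_ne_zero
  · exact h3

theorem anticomm_of_sq {u v : ℍ[ℝ]} (hu : u * u = -1) (hv : v * v = -1)
    (huv : (u * v) * (u * v) = -1) : v * u = -(u * v) := by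
  calc v * u = (u * u) * (v * u) * (v * v) := by rw [hu, hv]; simp
    _ = u * ((u * v) * (u * v)) * v := by simp only [mul_assoc]
    _ = -(u * v) := by rw [huv]; simp

theorem twist_mul {G : Type*} (ρ χ ψ : G → ℍ[ℝ])
    (hχ : ∀ x, χ x = 1 ∨ χ x = -1) (hψ : ∀ x, ψ x = 1 ∨ ψ x = -1)
    (p q : ℍ[ℝ]) (hp : ∀ x, p * ρ x = χ x * (ρ x * p))
    (hq : ∀ x, q * ρ x = ψ x * (ρ x * q)) (x : G) :
    (p * q) * ρ x = (χ x * ψ x) * (ρ x * (p * q)) := by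
  have h1 := hp x
  have h2 := hq x
  rw [mul_assoc, h2]
  rcases hχ x with a | a <;> rcases hψ x with b | b <;> rw [a] at h1 ⊢ <;> rw [b] <;>
    simp only [neg_mul, one_mul, mul_neg, neg_neg] at h1 ⊢ <;>
    rw [← mul_assoc, h1] <;> simp [mul_assoc]

theorem twist_of_conj {r a u : ℍ[ℝ]} (hu : ‖u‖ = 1) (ha : a = 1 ∨ a = -1)
    (h : a * r = u * r * u⁻¹) : u * r = a * (r * u) := by
  have hu0 : u ≠ 0 := by
    intro h0
    simp [h0] at hu
  rw [← mul_assoc, h, mul_assoc, inv_mul_cancel₀ hu0, mul_one]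

theorem pm_mul {a b : ℍ[ℝ]} (ha : a = 1 ∨ a = -1) (hb : b = 1 ∨ b = -1) :
    a * b = 1 ∨ a * b = -1 := by
  rcases ha with rfl | rfl <;> rcases hb with rfl | rfl <;> simp

/-- Let `α, β, γ : G → {±1}` be homomorphisms that are linearly independent in
`Hom(G, ℤ/2)` (every product of a nonempty subset of `{α, β, γ}` is nontrivial).  Then
there is no irreducible projective representation `ρ : G → Sp(1)` such that each of
`ρ^α`, `ρ^β`, `ρ^γ` is conjugate to `ρ` in `Sp(1)`, where `ρ^χ(x) = χ(x)·ρ(x)`. -/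
theorem no_fixed_point_of_full_action {G : Type*} [Group G]
    (α β γ : G → ℍ[ℝ])
    (hα : ∀ x, α x = 1 ∨ α x = -1) (hβ : ∀ x, β x = 1 ∨ β x = -1)
    (hγ : ∀ x, γ x = 1 ∨ γ x = -1)
    (hαhom : ∀ x y : G, α (x * y) = α x * α y)
    (hβhom : ∀ x y : G, β (x * y) = β x * β y)
    (hγhom : ∀ x y : G, γ (x * y) = γ x * γ y)
    (hαnt : ∃ x : G, α x ≠ 1) (hβnt : ∃ x : G, β x ≠ 1) (hγnt : ∃ x : G, γ x ≠ 1)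
    (hαβnt : ∃ x : G, α x * β x ≠ 1) (hαγnt : ∃ x : G, α x * γ x ≠ 1)
    (hβγnt : ∃ x : G, β x * γ x ≠ 1) (hαβγnt : ∃ x : G, α x * β x * γ x ≠ 1) :
    ¬ ∃ ρ : G → ℍ[ℝ],
      (∀ g, ‖ρ g‖ = 1) ∧
      (∀ g h : G, ρ (g * h) * (ρ h)⁻¹ * (ρ g)⁻¹ = 1 ∨
        ρ (g * h) * (ρ h)⁻¹ * (ρ g)⁻¹ = -1) ∧
      (∀ z : ℍ[ℝ], ‖z‖ = 1 → (∀ x : G, z * ρ x = ρ x * z) → z = 1 ∨ z = -1) ∧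
      (∃ u : ℍ[ℝ], ‖u‖ = 1 ∧ ∀ x : G, α x * ρ x = u * ρ x * u⁻¹) ∧
      (∃ v : ℍ[ℝ], ‖v‖ = 1 ∧ ∀ x : G, β x * ρ x = v * ρ x * v⁻¹) ∧
      (∃ w : ℍ[ℝ], ‖w‖ = 1 ∧ ∀ x : G, γ x * ρ x = w * ρ x * w⁻¹) := by
  rintro ⟨ρ, hρ, -, hirr, ⟨u, hu, hu'⟩, ⟨v, hv, hv'⟩, ⟨w, hw, hw'⟩⟩
  have tu := fun x => twist_of_conj hu (hα x) (hu' x)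
  have tv := fun x => twist_of_conj hv (hβ x) (hv' x)
  have tw := fun x => twist_of_conj hw (hγ x) (hw' x)
  have hαβ := fun x => pm_mul (hα x) (hβ x)
  have tuv := twist_mul ρ α β hα hβ u v tu tv
  have tuw := twist_mul ρ α γ hα hγ u w tu tw
  have tvw := twist_mul ρ β γ hβ hγ v w tv tw
  have tuvw := twist_mul ρ (fun x => α x * β x) γ hαβ hγ (u * v) w tuv tw
  have su := sq_eq_neg_one_of_twist ρ α hα hαnt hρ hirr u hu tu
  have sv := sq_eq_neg_one_of_twist ρ β hβ hβnt hρ hirr v hv tv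
  have sw := sq_eq_neg_one_of_twist ρ γ hγ hγnt hρ hirr w hw tw
  have suv := sq_eq_neg_one_of_twist ρ (fun x => α x * β x) hαβ hαβnt hρ hirr (u * v)
    (by simp [hu, hv]) tuv
  have suw := sq_eq_neg_one_of_twist ρ (fun x => α x * γ x) (fun x => pm_mul (hα x) (hγ x))
    hαγnt hρ hirr (u * w) (by simp [hu, hw]) tuw
  have svw := sq_eq_neg_one_of_twist ρ (fun x => β x * γ x) (fun x => pm_mul (hβ x) (hγ x))
    hβγnt hρ hirr (v * w) (by simp [hv, hw]) tvw
  have suvw := sq_eq_neg_one_of_twist ρ (fun x => α x * β x * γ x)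
    (fun x => pm_mul (hαβ x) (hγ x)) hαβγnt hρ hirr (u * v * w) (by simp [hu, hv, hw]) tuvw
  have avu := anticomm_of_sq su sv suv
  have awu := anticomm_of_sq su sw suw
  have h1 : (u * v * w) * (u * v * w) = 1 := by
    calc (u * v * w) * (u * v * w) = u * v * (w * u) * (v * w) := by simp only [mul_assoc]
      _ = -(u * (v * u) * (w * (v * w))) := by rw [awu]; simp only [mul_assoc, neg_mul, mul_neg]
      _ = (u * u) * ((v * w) * (v * w)) := by
        rw [avu]; simp only [mul_assoc, neg_mul, mul_neg, neg_neg]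
      _ = 1 := by rw [su, svw]; simp
  rw [h1] at suvw
  have := congrArg (fun q : ℍ[ℝ] => q.re) suvw
  norm_num at this
end

section
/- Let G be a group and K ≤ G the subgroup generated by all commutators and all squares of elements of G (so that G/K is the mod-2 abelianization of G). Let ρ : G → Sp(1) be an irreducible projective representation. Then the following are equivalent: (1) there exist linearly independent homomorphisms α, β : G → {±1} (i.e. α, β, α·β all nontrivial) such that ρ^α and ρ^β are each conjugate to ρ in Sp(1); (2) ρ(k) ∈ {±1} for every k ∈ K. -/
open Quaternion


theorem aux_i : ∃ i : ℍ[ℝ], ‖i‖ = 1 ∧ i ≠ 1 ∧ i ≠ -1 := by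
  obtain ⟨i, h0, h1, h2, h3⟩ : ∃ i : ℍ[ℝ], i.re = 0 ∧ i.imI = 1 ∧ i.imJ = 0 ∧ i.imK = 0 :=
    ⟨⟨0, 1, 0, 0⟩, rfl, rfl, rfl, rfl⟩
  refine ⟨i, ?_, ?_, ?_⟩
  · have h := Quaternion.normSq_eq_norm_mul_self i
    rw [Quaternion.normSq_def', h0, h1, h2, h3] at h
    have hn := norm_nonneg i
    nlinarith
  · rintro rfl
    simp at h0
  · rintro rfl
    simp at h0

theorem aux_real (z u v : ℍ[ℝ]) (hz : ‖z‖ = 1) (h1 : z * u = u * z) (h2 : z * v = v * z)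
    (h3 : u * v ≠ v * u) : z = 1 ∨ z = -1 := by
  have key : z.imI = 0 ∧ z.imJ = 0 ∧ z.imK = 0 := by
    by_contra hne
    apply h3
    rw [Quaternion.ext_iff] at h1 h2
    simp only [Quaternion.re_mul, Quaternion.imI_mul, Quaternion.imJ_mul,
      Quaternion.imK_mul] at h1 h2
    obtain ⟨-, a1, a2, a3⟩ := h1
    obtain ⟨-, b1, b2, b3⟩ := h2
    have a1 : z.imJ * u.imK = z.imK * u.imJ := by linarith
    have a2 : z.imK * u.imI = z.imI * u.imK := by linarith
    have a3 : z.imI * u.imJ = z.imJ * u.imI := by linarith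
    have b1 : z.imJ * v.imK = z.imK * v.imJ := by linarith
    have b2 : z.imK * v.imI = z.imI * v.imK := by linarith
    have b3 : z.imI * v.imJ = z.imJ * v.imI := by linarith
    have c : u.imJ * v.imK = u.imK * v.imJ ∧ u.imK * v.imI = u.imI * v.imK ∧
        u.imI * v.imJ = u.imJ * v.imI := by
      have hnez : z.imI ≠ 0 ∨ z.imJ ≠ 0 ∨ z.imK ≠ 0 := by tauto
      rcases hnez with h | h | h
      all_goals refine ⟨mul_left_cancel₀ h ?_, mul_left_cancel₀ h ?_, mul_left_cancel₀ h ?_⟩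
      all_goals grind
    obtain ⟨c1, c2, c3⟩ := c
    ext <;> simp only [Quaternion.re_mul, Quaternion.imI_mul, Quaternion.imJ_mul,
      Quaternion.imK_mul] <;> linarith
  obtain ⟨k1, k2, k3⟩ := key
  have hn : z * z = 1 := by
    have h := Quaternion.normSq_eq_norm_mul_self z
    rw [hz, Quaternion.normSq_def'] at h
    ext <;> simp [k1, k2, k3] at h ⊢
    rcases h with h | h <;> simp [h]
  exact mul_self_eq_one_iff.mp hn

theorem aux_mul {G : Type*} [Group G] (ρ : G → ℍ[ℝ]) (hρ : ∀ g, ‖ρ g‖ = 1)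
    (hpr : ∀ g h : G, ρ (g * h) * (ρ h)⁻¹ * (ρ g)⁻¹ = 1 ∨
      ρ (g * h) * (ρ h)⁻¹ * (ρ g)⁻¹ = -1) (g h : G) :
    ρ (g * h) = ρ g * ρ h ∨ ρ (g * h) = -(ρ g * ρ h) := by
  have n : ∀ g, ρ g ≠ 0 := fun g hg => by simpa [hg] using hρ g
  rcases hpr g h with e | e
  · left
    rw [mul_inv_eq_iff_eq_mul₀ (n g), mul_inv_eq_iff_eq_mul₀ (n h)] at e
    simpa using e
  · right
    rw [mul_inv_eq_iff_eq_mul₀ (n g), mul_inv_eq_iff_eq_mul₀ (n h)] at e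
    simpa using e

theorem aux_char {G : Type*} [Group G] (ρ : G → ℍ[ℝ]) (hρ : ∀ g, ‖ρ g‖ = 1)
    (hm : ∀ g h : G, ρ (g * h) = ρ g * ρ h ∨ ρ (g * h) = -(ρ g * ρ h))
    (hc : ∀ g h : G, ρ g * ρ h = ρ h * ρ g ∨ ρ g * ρ h = -(ρ h * ρ g)) (a : G) :
    ∃ α : G → ℍ[ℝ], (∀ x, α x = 1 ∨ α x = -1) ∧ (∀ x y : G, α (x * y) = α x * α y) ∧
      (∀ x, α x * ρ x = ρ a * ρ x * (ρ a)⁻¹) := by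
  have n : ∀ g, ρ g ≠ 0 := fun g hg => by simpa [hg] using hρ g
  have h : ∀ x, ∃ e : ℍ[ℝ], (e = 1 ∨ e = -1) ∧ e * ρ x = ρ a * ρ x * (ρ a)⁻¹ := by
    intro x
    rcases hc a x with e | e
    · exact ⟨1, Or.inl rfl, by rw [e]; simp [mul_assoc, n a]⟩
    · exact ⟨-1, Or.inr rfl, by rw [e]; simp [mul_assoc, n a]⟩
  choose α h1 h2 using h
  refine ⟨α, h1, ?_, h2⟩
  intro x y
  have e : ρ a * (ρ x * ρ y) * (ρ a)⁻¹ = α x * α y * (ρ x * ρ y) := by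
    have : ρ a * (ρ x * ρ y) * (ρ a)⁻¹
        = (ρ a * ρ x * (ρ a)⁻¹) * (ρ a * ρ y * (ρ a)⁻¹) := by
      simp [mul_assoc, n a]
    rw [this, ← h2, ← h2]
    rcases h1 y with q | q <;> simp [q, mul_assoc]
  apply mul_right_cancel₀ (n (x * y))
  rw [h2]
  rcases hm x y with q | q
  · rw [q, e]
  · rw [q, mul_neg, neg_mul, e, mul_neg]

theorem aux_sq {G : Type*} [Group G] (ρ : G → ℍ[ℝ]) 
    (hirr : ∀ z : ℍ[ℝ], ‖z‖ = 1 → (∀ x : G, z * ρ x = ρ x * z) → z = 1 ∨ z = -1)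
    (α : G → ℍ[ℝ]) (h1 : ∀ x, α x = 1 ∨ α x = -1) (u : ℍ[ℝ]) (hu : ‖u‖ = 1)
    (hne : ∃ x, α x ≠ 1) (hn : ∀ x, ρ x ≠ 0)
    (h : ∀ x, α x * ρ x * u = u * ρ x) : u * u = -1 := by
  have h2 : u * u = 1 ∨ u * u = -1 := by
    apply hirr
    · simp [hu]
    · intro x
      have := h x
      rcases h1 x with q | q
      · rw [q, one_mul] at this
        rw [mul_assoc, ← this, ← mul_assoc, ← this, mul_assoc]
      · rw [q, neg_one_mul, neg_mul] at this
        rw [mul_assoc, ← this, mul_neg, ← mul_assoc, ← this, neg_mul, neg_neg, mul_assoc]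
  rcases h2 with h2 | h2
  · exfalso
    obtain ⟨x, hx⟩ := hne
    apply hx
    have := h x
    rcases mul_self_eq_one_iff.mp h2 with q | q
    · apply mul_right_cancel₀ (hn x); simpa [q] using this
    · apply mul_right_cancel₀ (hn x); simpa [q] using this
  · exact h2

/-- Let `K ≤ G` be the subgroup generated by all commutators and all squares (the kernel
of the map to the mod-2 abelianization), and let `ρ : G → Sp(1)` be an irreducible
projective representation.  The following are equivalent: (1) there exist linearly
independent homomorphisms `α, β : G → {±1}` with `ρ^α` and `ρ^β` each conjugate to `ρ`
in `Sp(1)`; (2) `ρ(k) ∈ {±1}` for every `k ∈ K`. -/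
theorem stabilizer_klein_iff_rho_central_on_K {G : Type*} [Group G]
    (K : Subgroup G)
    (hK : K = Subgroup.closure
      ({x : G | ∃ g h : G, x = g * h * g⁻¹ * h⁻¹} ∪ {x : G | ∃ g : G, x = g ^ 2}))
    (ρ : G → ℍ[ℝ]) (hρ : ∀ g, ‖ρ g‖ = 1)
    (hpr : ∀ g h : G, ρ (g * h) * (ρ h)⁻¹ * (ρ g)⁻¹ = 1 ∨
      ρ (g * h) * (ρ h)⁻¹ * (ρ g)⁻¹ = -1)
    (hirr : ∀ z : ℍ[ℝ], ‖z‖ = 1 → (∀ x : G, z * ρ x = ρ x * z) → z = 1 ∨ z = -1) :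
    (∃ α β : G → ℍ[ℝ],
      (∀ x, α x = 1 ∨ α x = -1) ∧ (∀ x, β x = 1 ∨ β x = -1) ∧
      (∀ x y : G, α (x * y) = α x * α y) ∧ (∀ x y : G, β (x * y) = β x * β y) ∧
      (∃ x : G, α x ≠ 1) ∧ (∃ x : G, β x ≠ 1) ∧ (∃ x : G, α x * β x ≠ 1) ∧
      (∃ u : ℍ[ℝ], ‖u‖ = 1 ∧ ∀ x : G, α x * ρ x = u * ρ x * u⁻¹) ∧
      (∃ v : ℍ[ℝ], ‖v‖ = 1 ∧ ∀ x : G, β x * ρ x = v * ρ x * v⁻¹)) ↔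
    (∀ k : G, k ∈ K → ρ k = 1 ∨ ρ k = -1) := by
  have n : ∀ g, ρ g ≠ 0 := fun g hg => by simpa [hg] using hρ g
  have hm := aux_mul ρ hρ hpr
  constructor
  · rintro ⟨α, β, hα, hβ, mα, mβ, nα, nβ, nαβ, ⟨u, hu, hu2⟩, ⟨v, hv, hv2⟩⟩ k hk
    have u0 : u ≠ 0 := fun h => by simp [h] at hu
    have v0 : v ≠ 0 := fun h => by simp [h] at hv
    have hu3 : ∀ x, α x * ρ x * u = u * ρ x := fun x => by
      rw [hu2, mul_assoc, inv_mul_cancel₀ u0, mul_one]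
    have hv3 : ∀ x, β x * ρ x * v = v * ρ x := fun x => by
      rw [hv2, mul_assoc, inv_mul_cancel₀ v0, mul_one]
    have su := aux_sq ρ hirr α hα u hu nα n hu3
    have sv := aux_sq ρ hirr β hβ v hv nβ n hv3
    have huv : u * v ≠ v * u := by
      intro hc
      have h1 : (u * v) * (u * v) = 1 := by
        calc (u * v) * (u * v) = u * (v * u) * v := by simp only [mul_assoc]
          _ = (u * u) * (v * v) := by rw [← hc]; simp only [mul_assoc]
          _ = 1 := by rw [su, sv]; simp
      obtain ⟨x, hx⟩ := nαβ
      apply hx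
      apply mul_right_cancel₀ (n x)
      apply mul_right_cancel₀ (mul_ne_zero u0 v0)
      have e : α x * β x * ρ x * (u * v) = u * v * ρ x := by
        have e1 := hu3 x
        have e2 := hv3 x
        rw [mul_assoc u, ← e2]
        rcases hβ x with q | q
        · rw [q, mul_one, one_mul, ← mul_assoc, e1, mul_assoc]
        · rw [q, mul_neg_one, neg_one_mul, neg_mul, neg_mul, neg_mul, mul_neg, ← mul_assoc,
            e1, mul_assoc]
      rw [e]
      rcases mul_self_eq_one_iff.mp h1 with q | q <;> simp [q]
    have one : ∀ (γ : G → ℍ[ℝ]), (∀ x, γ x = 1 ∨ γ x = -1) →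
        (∀ x y : G, γ (x * y) = γ x * γ y) → γ k = 1 := by
      intro γ hγ mγ
      have h1 : γ 1 = 1 := by
        have := mγ 1 1
        rcases hγ 1 with q | q
        · exact q
        · rw [mul_one, q] at this; simpa [q] using this
      let f : G →* ℍ[ℝ] := ⟨⟨γ, h1⟩, mγ⟩
      have hinv : ∀ x, γ x * γ x⁻¹ = 1 := fun x => by rw [← mγ, mul_inv_cancel, h1]
      have hle : K ≤ f.ker := by
        rw [hK, Subgroup.closure_le]
        rintro x (⟨g, h, rfl⟩ | ⟨g, rfl⟩)
        · change γ _ = 1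
          have hg := hinv g
          have hh := hinv h
          rw [mγ, mγ, mγ]
          rcases hγ g with q | q <;> rcases hγ h with r | r <;> rcases hγ g⁻¹ with qinv | qinv <;>
            rcases hγ h⁻¹ with rinv | rinv <;> rw [q, qinv] at hg <;> rw [r, rinv] at hh <;>
            rw [q, r, qinv, rinv] <;> simp_all
        · change γ _ = 1
          rw [pow_two, mγ]
          rcases hγ g with q | q <;> simp [q]
      exact hle hk
    have ck := hu3 k
    have dk := hv3 k
    rw [one α hα mα, one_mul] at ck
    rw [one β hβ mβ, one_mul] at dk
    exact aux_real (ρ k) u v (hρ k) ck dk huv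
  · intro H
    have hc : ∀ g h : G, ρ g * ρ h = ρ h * ρ g ∨ ρ g * ρ h = -(ρ h * ρ g) := by
      intro g h
      have hk : g * h * g⁻¹ * h⁻¹ ∈ K := by
        rw [hK]; exact Subgroup.subset_closure (Or.inl ⟨g, h, rfl⟩)
      have e : g * h = (g * h * g⁻¹ * h⁻¹) * (h * g) := by group
      have e1 := hm (g * h * g⁻¹ * h⁻¹) (h * g)
      rw [← e] at e1
      have e2 := hm g h
      have e3 := hm h g
      have e4 := H _ hk
      rcases e1 with e1 | e1 <;> rcases e2 with e2 | e2 <;> rcases e3 with e3 | e3 <;>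
        rcases e4 with e4 | e4 <;> rw [e2, e3, e4] at e1 <;> 
        simp only [neg_mul, mul_neg, one_mul, neg_neg, neg_inj] at e1 <;>
        first
        | exact Or.inl e1
        | exact Or.inr e1
        | exact Or.inr (by rw [← e1, neg_neg])
    obtain ⟨a, ha⟩ : ∃ a, ¬ (ρ a = 1 ∨ ρ a = -1) := by
      by_contra! hall
      obtain ⟨i, i1, i2, i3⟩ := aux_i
      rcases hirr i i1 (fun x => by rcases hall x with q | q <;> simp [q]) with q | q
      · exact i2 q
      · exact i3 q
    obtain ⟨b, hb⟩ : ∃ b, ρ a * ρ b ≠ ρ b * ρ a := by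
      by_contra! hall
      exact ha (hirr _ (hρ a) hall)
    obtain ⟨α, a1, a2, a3⟩ := aux_char ρ hρ hm hc a
    obtain ⟨β, b1, b2, b3⟩ := aux_char ρ hρ hm hc b
    have hαb : α b ≠ 1 := by
      intro q
      have := a3 b
      rw [q, one_mul, eq_mul_inv_iff_mul_eq₀ (n a)] at this
      exact hb this.symm
    have hβa : β a ≠ 1 := by
      intro q
      have := b3 a
      rw [q, one_mul, eq_mul_inv_iff_mul_eq₀ (n b)] at this
      exact hb this
    have hαa : α a = 1 := by
      have := a3 a
      rw [mul_assoc, mul_inv_cancel₀ (n a), mul_one] at this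
      exact mul_right_cancel₀ (n a) (by rw [this, one_mul])
    exact ⟨α, β, a1, b1, a2, b2, ⟨b, hαb⟩, ⟨a, hβa⟩, ⟨a, by rwa [hαa, one_mul]⟩,
      ⟨ρ a, hρ a, a3⟩, ⟨ρ b, hρ b, b3⟩⟩
end

section
/- Let P = Sp(1)/{±1} be the quotient of the group of unit quaternions by its center (a group isomorphic to SO(3)). Then any two subgroups of P isomorphic to the Klein four-group ℤ/2 × ℤ/2 are conjugate in P; moreover, for any two such subgroups H₁, H₂ and any group isomorphism f : H₁ → H₂ there exists g ∈ P such that f(x) = g·x·g⁻¹ for all x ∈ H₁ (every isomorphism between Klein four-subgroups is realized by conjugation). -/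
open Quaternion

/-- `Sp(1)`: the group of unit quaternions. -/
noncomputable abbrev Sp1 : Type := Metric.sphere (0 : ℍ[ℝ]) 1

/-- `P = Sp(1)` modulo its center `{±1}`; this group is isomorphic to `SO(3)`. -/
noncomputable abbrev PSp1 : Type := Sp1 ⧸ Subgroup.center Sp1

/-- The Klein four-group `ℤ/2 × ℤ/2` (written multiplicatively). -/
abbrev KleinFour : Type := Multiplicative (ZMod 2 × ZMod 2)

/-- The quaternion with given coordinates. -/
def qmk (r x y z : ℝ) : ℍ[ℝ] := QuaternionAlgebra.mk r x y z

lemma qmk_re (r x y z : ℝ) : (qmk r x y z).re = r := rfl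
lemma qmk_imI (r x y z : ℝ) : (qmk r x y z).imI = x := rfl
lemma qmk_imJ (r x y z : ℝ) : (qmk r x y z).imJ = y := rfl
lemma qmk_imK (r x y z : ℝ) : (qmk r x y z).imK = z := rfl

/-- A unit quaternion commuting with all unit quaternions is real. -/
lemma center_im (z : Sp1) (hz : z ∈ Subgroup.center Sp1) :
    (z : ℍ[ℝ]).imI = 0 ∧ (z : ℍ[ℝ]).imJ = 0 ∧ (z : ℍ[ℝ]).imK = 0 := by
  rw [Subgroup.mem_center_iff] at hz
  have hi : (qmk 0 1 0 0) ∈ Metric.sphere (0 : ℍ[ℝ]) 1 := by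
    have h : ‖(qmk 0 1 0 0)‖ * ‖(qmk 0 1 0 0)‖ = 1 := by
      rw [← Quaternion.normSq_eq_norm_mul_self, Quaternion.normSq_def']; norm_num [qmk_re, qmk_imI, qmk_imJ, qmk_imK]
    rw [mem_sphere_zero_iff_norm]
    nlinarith [norm_nonneg (qmk 0 1 0 0)]
  have hj : (qmk 0 0 1 0) ∈ Metric.sphere (0 : ℍ[ℝ]) 1 := by
    have h : ‖(qmk 0 0 1 0)‖ * ‖(qmk 0 0 1 0)‖ = 1 := by
      rw [← Quaternion.normSq_eq_norm_mul_self, Quaternion.normSq_def']; norm_num [qmk_re, qmk_imI, qmk_imJ, qmk_imK]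
    rw [mem_sphere_zero_iff_norm]
    nlinarith [norm_nonneg (qmk 0 0 1 0)]
  have h1 : (qmk 0 1 0 0) * z = z * (qmk 0 1 0 0) := congrArg Subtype.val (hz ⟨_, hi⟩)
  have h2 : (qmk 0 0 1 0) * z = z * (qmk 0 0 1 0) := congrArg Subtype.val (hz ⟨_, hj⟩)
  have a1 := congrArg QuaternionAlgebra.imJ h1
  have a2 := congrArg QuaternionAlgebra.imK h1
  have a3 := congrArg QuaternionAlgebra.imK h2
  simp [qmk_re, qmk_imI, qmk_imJ, qmk_imK] at a1 a2 a3
  refine ⟨?_, ?_, ?_⟩ <;> linarith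

lemma mem_center_of_im (z : Sp1) (h1 : (z : ℍ[ℝ]).imI = 0) (h2 : (z : ℍ[ℝ]).imJ = 0)
    (h3 : (z : ℍ[ℝ]).imK = 0) : z ∈ Subgroup.center Sp1 := by
  rw [Subgroup.mem_center_iff]
  intro g
  apply Subtype.ext
  change (g : ℍ[ℝ]) * z = z * g
  ext <;> simp [h1, h2, h3, mul_comm]

lemma unit_sq (z : Sp1) : (z : ℍ[ℝ]).re ^ 2 + (z : ℍ[ℝ]).imI ^ 2 + (z : ℍ[ℝ]).imJ ^ 2
    + (z : ℍ[ℝ]).imK ^ 2 = 1 := by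
  rw [← Quaternion.normSq_def', Quaternion.normSq_eq_norm_mul_self,
    mem_sphere_zero_iff_norm.1 z.2, one_mul]

/-- Lifts of involutions of the quotient are purely imaginary. -/
lemma lift_re_zero (a : Sp1) (ha : (a : PSp1) ≠ 1) (ha2 : (a : PSp1) * a = 1) :
    (a : ℍ[ℝ]).re = 0 := by
  rw [← QuotientGroup.mk_mul, QuotientGroup.eq_one_iff] at ha2
  obtain ⟨h1, h2, h3⟩ := center_im _ ha2
  by_contra hr
  apply ha
  rw [QuotientGroup.eq_one_iff]
  have hc : ((a * a : Sp1) : ℍ[ℝ]) = (a : ℍ[ℝ]) * a := rfl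
  rw [hc] at h1 h2 h3
  simp at h1 h2 h3
  have k : ∀ t : ℝ, (a : ℍ[ℝ]).re * t = 0 → t = 0 := fun t ht =>
    (mul_eq_zero.1 ht).resolve_left hr
  apply mem_center_of_im <;> apply k <;> linarith

lemma sq_neg_one (a : Sp1) (h : (a : ℍ[ℝ]).re = 0) : (a : ℍ[ℝ]) * a = -1 := by
  have := unit_sq a
  rw [h] at this
  ext <;> simp [h] <;> nlinarith

/-- Lifts of distinct commuting involutions have purely imaginary product. -/
lemma mul_re_zero (a b : Sp1) (ha : (a : PSp1) ≠ 1) (ha2 : (a : PSp1) * a = 1)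
    (hb2 : (b : PSp1) * b = 1) (hab : (a : PSp1) ≠ b)
    (hc : (a : PSp1) * b = b * a) : ((a : ℍ[ℝ]) * b).re = 0 := by
  refine lift_re_zero (a * b) ?_ ?_
  · rw [QuotientGroup.mk_mul]
    intro h
    apply hab
    calc (a : PSp1) = a * (b * b) := by rw [hb2, mul_one]
      _ = b := by rw [← mul_assoc, h, one_mul]
  · rw [QuotientGroup.mk_mul]
    calc (a : PSp1) * b * (a * b) = a * (b * a) * b := by simp only [mul_assoc]
      _ = (a * a) * (b * b) := by rw [← hc]; simp only [mul_assoc]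
      _ = 1 := by rw [ha2, hb2, one_mul]

lemma anticomm (a b : ℍ[ℝ]) (ha : a.re = 0) (hb : b.re = 0) (hc : (a * b).re = 0) :
    b * a = -(a * b) := by
  simp [ha, hb] at hc
  ext <;> simp [ha, hb] <;> linarith

/-- The averaged intertwiner. -/
noncomputable def avg (a b c d t : ℍ[ℝ]) : ℍ[ℝ] :=
  t - c * t * a - d * t * b - (c * d) * t * (a * b)

lemma avg_left (a b c d t : ℍ[ℝ]) (ha : a * a = -1) (hc : c * c = -1)
    (hab : b * a = -(a * b)) (_hcd : d * c = -(c * d)) :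
    avg a b c d t * a = c * avg a b c d t := by
  have h1 : a * b * a = b := by
    rw [mul_assoc, hab, mul_neg, ← mul_assoc, ha]; simp
  have h2 : c * (c * d) = -d := by rw [← mul_assoc, hc]; simp
  have e1 : c * t * a * a = - (c * t) := by rw [mul_assoc, ha]; simp
  have e2 : c * (c * t * a) = - (t * a) := by simp only [← mul_assoc]; rw [hc]; simp
  have e3 : c * d * t * (a * b) * a = c * d * t * b := by rw [mul_assoc, h1]
  have e4 : c * (c * d * t * (a * b)) = - (d * t * (a * b)) := by
    rw [← mul_assoc c, ← mul_assoc c (c * d), h2]; simp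
  have e5 : d * t * b * a = - (d * t * (a * b)) := by rw [mul_assoc, hab]; simp
  have e6 : c * (d * t * b) = c * d * t * b := by simp only [mul_assoc]
  simp only [avg, sub_mul, mul_sub]
  rw [e1, e2, e3, e4, e5, e6]
  abel

lemma avg_right (a b c d t : ℍ[ℝ]) (hb : b * b = -1) (hd : d * d = -1)
    (_hab : b * a = -(a * b)) (hcd : d * c = -(c * d)) :
    avg a b c d t * b = d * avg a b c d t := by
  have h2 : d * (c * d) = c := by
    rw [← mul_assoc, hcd, neg_mul, mul_assoc, hd]; simp
  have e1 : d * t * b * b = - (d * t) := by rw [mul_assoc, hb]; simp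
  have e2 : d * (d * t * b) = - (t * b) := by simp only [← mul_assoc]; rw [hd]; simp
  have e3 : c * d * t * (a * b) * b = - (c * d * t * a) := by
    rw [mul_assoc, mul_assoc a, hb]; simp
  have e4 : d * (c * d * t * (a * b)) = c * t * (a * b) := by
    rw [← mul_assoc d, ← mul_assoc d (c * d), h2]
  have e5 : c * t * a * b = c * t * (a * b) := by rw [mul_assoc]
  have e6 : d * (c * t * a) = - (c * d * t * a) := by
    simp only [← mul_assoc]; rw [hcd]; simp
  simp only [avg, sub_mul, mul_sub]
  rw [e1, e2, e3, e4, e5, e6]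
  abel

/-- Trace of `t ↦ p t q`. -/
lemma trace_lr (p q : ℍ[ℝ]) : (p * (qmk 1 0 0 0) * q).re + (p * (qmk 0 1 0 0) * q).imI
    + (p * (qmk 0 0 1 0) * q).imJ + (p * (qmk 0 0 0 1) * q).imK = 4 * p.re * q.re := by
  simp only [Quaternion.re_mul, Quaternion.imI_mul, Quaternion.imJ_mul, Quaternion.imK_mul,
    qmk_re, qmk_imI, qmk_imJ, qmk_imK]
  ring

lemma avg_ne (a b c d : ℍ[ℝ]) (ha : a.re = 0) (hb : b.re = 0) (hab : (a * b).re = 0) :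
    ∃ t, avg a b c d t ≠ 0 := by
  by_contra! h
  have h1 := congrArg QuaternionAlgebra.re (h (qmk 1 0 0 0))
  have h2 := congrArg QuaternionAlgebra.imI (h (qmk 0 1 0 0))
  have h3 := congrArg QuaternionAlgebra.imJ (h (qmk 0 0 1 0))
  have h4 := congrArg QuaternionAlgebra.imK (h (qmk 0 0 0 1))
  have t1 := trace_lr c a
  have t2 := trace_lr d b
  have t3 := trace_lr (c * d) (a * b)
  rw [ha] at t1
  rw [hb] at t2
  rw [hab] at t3
  simp only [avg, Quaternion.re_sub, Quaternion.imI_sub, Quaternion.imJ_sub,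
    Quaternion.imK_sub, Quaternion.re_zero, Quaternion.imI_zero, Quaternion.imJ_zero,
    Quaternion.imK_zero, qmk_re, qmk_imI, qmk_imJ, qmk_imK] at h1 h2 h3 h4
  linarith

/-- Two pairs of distinct commuting involutions in `PSp1` are simultaneously conjugate. -/
lemma pair_conj (x y x' y' : PSp1)
    (hx : x ≠ 1) (hy : y ≠ 1) (hxy : x ≠ y) (hx2 : x * x = 1) (hy2 : y * y = 1)
    (hc : x * y = y * x)
    (hx' : x' ≠ 1) (hy' : y' ≠ 1) (hxy' : x' ≠ y') (hx2' : x' * x' = 1) (hy2' : y' * y' = 1)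
    (hc' : x' * y' = y' * x') :
    ∃ g : PSp1, x' = g * x * g⁻¹ ∧ y' = g * y * g⁻¹ := by
  obtain ⟨a, rfl⟩ := QuotientGroup.mk_surjective x
  obtain ⟨b, rfl⟩ := QuotientGroup.mk_surjective y
  obtain ⟨c, rfl⟩ := QuotientGroup.mk_surjective x'
  obtain ⟨d, rfl⟩ := QuotientGroup.mk_surjective y'
  have ra := lift_re_zero a hx hx2
  have rb := lift_re_zero b hy hy2
  have rc := lift_re_zero c hx' hx2'
  have rd := lift_re_zero d hy' hy2'
  have rab := mul_re_zero a b hx hx2 hy2 hxy hc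
  have rcd := mul_re_zero c d hx' hx2' hy2' hxy' hc'
  have aab := anticomm _ _ ra rb rab
  have acd := anticomm _ _ rc rd rcd
  obtain ⟨t, ht⟩ := avg_ne (a : ℍ[ℝ]) b c d ra rb rab
  have l := avg_left (a : ℍ[ℝ]) b c d t (sq_neg_one a ra) (sq_neg_one c rc) aab acd
  have r := avg_right (a : ℍ[ℝ]) b c d t (sq_neg_one b rb) (sq_neg_one d rd) aab acd
  generalize avg (a : ℍ[ℝ]) b c d t = s at ht l r
  have hs : ‖s‖⁻¹ • s ∈ Metric.sphere (0 : ℍ[ℝ]) 1 := by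
    rw [mem_sphere_zero_iff_norm, norm_smul, norm_inv, norm_norm]
    exact inv_mul_cancel₀ (norm_ne_zero_iff.2 ht)
  have key : ∀ u v : Sp1, s * (u : ℍ[ℝ]) = v * s →
      (v : PSp1) = ((⟨_, hs⟩ : Sp1) : PSp1) * u * ((⟨_, hs⟩ : Sp1) : PSp1)⁻¹ := by
    intro u v h
    rw [eq_mul_inv_iff_mul_eq, ← QuotientGroup.mk_mul, ← QuotientGroup.mk_mul]
    congr 1
    apply Subtype.ext
    change (v : ℍ[ℝ]) * (‖s‖⁻¹ • s) = (‖s‖⁻¹ • s) * u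
    rw [mul_smul_comm, smul_mul_assoc, h]
  exact ⟨_, key a c l, key b d r⟩

lemma conj_cancel {G : Type*} [Group G] (g x w : G) (h : g * x * g⁻¹ = g * w * g⁻¹) :
    x = w := mul_left_cancel (mul_right_cancel h)

lemma iso_conj (H₁ H₂ : Subgroup PSp1) (e : H₁ ≃* KleinFour) (f : H₁ ≃* H₂) :
    ∃ g : PSp1, ∀ x : H₁, ((f x : PSp1) = g * (x : PSp1) * g⁻¹) := by
  let φ : KleinFour →* PSp1 := H₁.subtype.comp e.symm.toMonoidHom
  let ψ : KleinFour →* PSp1 := (H₂.subtype.comp f.toMonoidHom).comp e.symm.toMonoidHom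
  have hφ : Function.Injective φ := H₁.subtype_injective.comp e.symm.injective
  have hψ : Function.Injective ψ :=
    (H₂.subtype_injective.comp f.injective).comp e.symm.injective
  let p : KleinFour := Multiplicative.ofAdd (1, 0)
  let q : KleinFour := Multiplicative.ofAdd (0, 1)
  have hp : p ≠ 1 := by decide
  have hq : q ≠ 1 := by decide
  have hpq : p ≠ q := by decide
  have hp2 : p * p = 1 := by decide
  have hq2 : q * q = 1 := by decide
  have hall : ∀ z : KleinFour, z = 1 ∨ z = p ∨ z = q ∨ z = p * q := by decide
  have tr : ∀ (θ : KleinFour →* PSp1), Function.Injective θ →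
      θ p ≠ 1 ∧ θ q ≠ 1 ∧ θ p ≠ θ q ∧ θ p * θ p = 1 ∧ θ q * θ q = 1 ∧
        θ p * θ q = θ q * θ p := by
    intro θ hθ
    refine ⟨fun h => hp (hθ (h.trans θ.map_one.symm)), fun h => hq (hθ (h.trans θ.map_one.symm)),
      fun h => hpq (hθ h), ?_, ?_, ?_⟩
    · rw [← map_mul, hp2, map_one]
    · rw [← map_mul, hq2, map_one]
    · rw [← map_mul θ, ← map_mul θ, mul_comm p q]
  obtain ⟨h1, h2, h3, h4, h5, h6⟩ := tr φ hφ
  obtain ⟨k1, k2, k3, k4, k5, k6⟩ := tr ψ hψ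
  obtain ⟨g, gp, gq⟩ := pair_conj _ _ _ _ h1 h2 h3 h4 h5 h6 k1 k2 k3 k4 k5 k6
  have main : ∀ z, ψ z = g * φ z * g⁻¹ := by
    intro z
    rcases hall z with h | h | h | h <;> rw [h]
    · simp
    · exact gp
    · exact gq
    · rw [map_mul, map_mul, gp, gq]; group
  refine ⟨g, fun x => ?_⟩
  have := main (e x)
  have h1 : ψ (e x) = (f x : PSp1) :=
    congrArg (fun w : H₁ => (f w : PSp1)) (e.symm_apply_apply x)
  have h2 : φ (e x) = (x : PSp1) :=
    congrArg (fun w : H₁ => (w : PSp1)) (e.symm_apply_apply x)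
  rw [← h1, ← h2]
  exact this

/-- Any two Klein four-subgroups of `P = Sp(1)/{±1} ≅ SO(3)` are conjugate, and every
isomorphism between two Klein four-subgroups of `P` is realized by conjugation by an
element of `P`. -/
theorem klein_four_subgroups_conjugate
    (H₁ H₂ : Subgroup PSp1)
    (e₁ : Nonempty (H₁ ≃* KleinFour)) (e₂ : Nonempty (H₂ ≃* KleinFour)) :
    (∃ g : PSp1, ∀ x : PSp1, x ∈ H₁ ↔ g * x * g⁻¹ ∈ H₂) ∧
    ∀ f : H₁ ≃* H₂, ∃ g : PSp1, ∀ x : H₁, ((f x : PSp1) = g * (x : PSp1) * g⁻¹) := by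
  obtain ⟨e₁⟩ := e₁
  obtain ⟨e₂⟩ := e₂
  refine ⟨?_, fun f => iso_conj H₁ H₂ e₁ f⟩
  obtain ⟨g, hg⟩ := iso_conj H₁ H₂ e₁ (e₁.trans e₂.symm)
  refine ⟨g, fun x => ⟨fun hx => ?_, fun hx => ?_⟩⟩
  · rw [← hg ⟨x, hx⟩]
    exact SetLike.coe_mem _
  · obtain ⟨w, hw⟩ := (e₁.trans e₂.symm).surjective ⟨_, hx⟩
    have h := hg w
    rw [hw] at h
    have h' : x = (w : PSp1) := conj_cancel _ _ _ h
    rw [h']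
    exact w.2
end
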